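/- arXiv:0903.3308 — 3 statements merged into one kernel-verified Lean document; each statement's English description precedes it below -/
import Mathlib

section
/- (Part (2) of the key lattice lemma, type A.) For every integer l ≥ 1 and all indices 1 ≤ i, j ≤ l, if e_i^∨ − e_j^∨ is a linear combination of e_1,…,e_l with nonnegative integer coefficients, then either ⟨e_i^∨, e_i^∨⟩ > ⟨e_j^∨, e_j^∨⟩ or i = j. -/
open Finset

/-- Negated Cartan matrix of the root lattice of type `A_l` (indices `0,…,l-1`
correspond to `e_1,…,e_l`). -/
def cartanA (l : ℕ) (i j : Fin l) : ℚ :=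
  if i = j then -2 else if ((i : ℕ) + 1 = (j : ℕ) ∨ (j : ℕ) + 1 = (i : ℕ)) then 1 else 0

/-- The symmetric bilinear form of the negative-definite root lattice of type `A_l`. -/
def bilinA (l : ℕ) (x y : Fin l → ℚ) : ℚ :=
  ∑ i, ∑ j, x i * cartanA l i j * y j

/-- The standard basis vector `e_j`. -/
def eA (l : ℕ) (j : Fin l) : Fin l → ℚ := fun k => if k = j then 1 else 0

/-- `v` is the dual basis vector `e_i^∨`, i.e. `⟨v, e_k⟩ = δ_{ik}` for all `k`. -/
def IsDualA (l : ℕ) (v : Fin l → ℚ) (i : Fin l) : Prop :=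
  ∀ k : Fin l, bilinA l v (eA l k) = if k = i then 1 else 0

lemma bilinA_eA (l : ℕ) (x : Fin l → ℚ) (k : Fin l) :
    bilinA l x (eA l k) = ∑ i, x i * cartanA l i k := by
  simp [bilinA, eA]

lemma bilinA_eq_sum_mul (l : ℕ) (x y : Fin l → ℚ) :
    bilinA l x y = ∑ k, bilinA l x (eA l k) * y k := by
  simp only [bilinA_eA, Finset.sum_mul]
  rw [Finset.sum_comm]
  rfl

lemma cartanA_comm (l : ℕ) (i j : Fin l) : cartanA l i j = cartanA l j i := by
  simp only [cartanA, eq_comm (a := i) (b := j), or_comm]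

lemma bilinA_comm (l : ℕ) (x y : Fin l → ℚ) : bilinA l x y = bilinA l y x := by
  unfold bilinA
  rw [Finset.sum_comm]
  refine Finset.sum_congr rfl fun i _ => Finset.sum_congr rfl fun j _ => ?_
  rw [cartanA_comm l j i]
  ring

/-- Pairing with `e_i^∨` extracts the `i`-th coordinate. -/
lemma IsDualA.bilinA_eq {l : ℕ} {v : Fin l → ℚ} {i : Fin l} (hv : IsDualA l v i)
    (y : Fin l → ℚ) : bilinA l v y = y i := by
  rw [bilinA_eq_sum_mul]
  simp [hv _]

lemma cartanA_nonneg_of_ne {l : ℕ} {i j : Fin l} (hij : i ≠ j) : 0 ≤ cartanA l i j := by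
  unfold cartanA
  rw [if_neg hij]
  split_ifs <;> norm_num

/-- A vector with nonnegative coordinates that pairs negatively with `e_j` has positive
`j`-th coordinate. -/
lemma pos_of_bilinA_eA_neg {l : ℕ} {x : Fin l → ℚ} (hx : ∀ k, 0 ≤ x k) {j : Fin l}
    (h : bilinA l x (eA l j) < 0) : 0 < x j := by
  refine (hx j).lt_of_ne fun hj => h.not_ge ?_
  rw [bilinA_eA]
  refine Finset.sum_nonneg fun k _ => ?_
  rcases eq_or_ne k j with rfl | hk
  · simp [← hj]
  · exact mul_nonneg (hx k) (cartanA_nonneg_of_ne hk)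

/-- Part (2) of the key lattice lemma, type `A`: if `e_i^∨ − e_j^∨` is a nonnegative
integral linear combination of `e_1,…,e_l`, then `⟨e_i^∨,e_i^∨⟩ > ⟨e_j^∨,e_j^∨⟩`
or `i = j`. -/
theorem dual_diff_nonneg_A (l : ℕ) (hl : 1 ≤ l) (i j : Fin l) (v w : Fin l → ℚ)
    (hv : IsDualA l v i) (hw : IsDualA l w j)
    (h : ∃ c : Fin l → ℕ, v - w = ∑ k, (c k : ℚ) • eA l k) :
    bilinA l v v > bilinA l w w ∨ i = j := by
  obtain ⟨c, hc⟩ := h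
  refine or_iff_not_imp_right.2 fun hij => ?_
  have hnonneg : ∀ k, 0 ≤ (v - w) k := fun k => by
    rw [hc]
    simp [eA]
  have hneg : bilinA l (v - w) (eA l j) < 0 := by
    have hsub : bilinA l (v - w) (eA l j) = bilinA l v (eA l j) - bilinA l w (eA l j) := by
      simp only [bilinA_eA, Pi.sub_apply, sub_mul, Finset.sum_sub_distrib]
    rw [hsub, hv j, hw j, if_neg (Ne.symm hij), if_pos rfl]
    norm_num
  have hpos := pos_of_bilinA_eA_neg hnonneg hneg
  have hi := hnonneg i
  have hsymm : w i = v j := by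
    rw [← hv.bilinA_eq w, bilinA_comm, hw.bilinA_eq v]
  rw [hv.bilinA_eq, hw.bilinA_eq]
  simp only [Pi.sub_apply] at hpos hi
  linarith
end

section
/- (Part (2) of the key lattice lemma, type D.) For every integer m ≥ 4 and all indices 1 ≤ i, j ≤ m, if e_i^∨ − e_j^∨ is a linear combination of e_1,…,e_m with nonnegative integer coefficients, then either ⟨e_i^∨, e_i^∨⟩ > ⟨e_j^∨, e_j^∨⟩ or i = j. -/
open Finset

/-- Negated Cartan matrix of the root lattice of type `D_m` (indices `0,…,m-1`
correspond to `e_1,…,e_m`; the Dynkin diagram is the chain `e_2—e_3—⋯—e_m` with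
`e_1` attached to `e_3`). -/
def cartanD (m : ℕ) (i j : Fin m) : ℚ :=
  if i = j then -2
  else if ((i : ℕ) = 0 ∧ (j : ℕ) = 2) ∨ ((i : ℕ) = 2 ∧ (j : ℕ) = 0) then 1
  else if (((i : ℕ) + 1 = (j : ℕ) ∨ (j : ℕ) + 1 = (i : ℕ)) ∧ 1 ≤ (i : ℕ) ∧ 1 ≤ (j : ℕ))
    then 1 else 0

/-- The symmetric bilinear form of the negative-definite root lattice of type `D_m`. -/
def bilinD (m : ℕ) (x y : Fin m → ℚ) : ℚ :=
  ∑ i, ∑ j, x i * cartanD m i j * y j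

/-- The standard basis vector `e_j`. -/
def eD (m : ℕ) (j : Fin m) : Fin m → ℚ := fun k => if k = j then 1 else 0

/-- `v` is the dual basis vector `e_i^∨`, i.e. `⟨v, e_k⟩ = δ_{ik}` for all `k`. -/
def IsDualD (m : ℕ) (v : Fin m → ℚ) (i : Fin m) : Prop :=
  ∀ k : Fin m, bilinD m v (eD m k) = if k = i then 1 else 0

theorem cartanD_symm (m : ℕ) (i j : Fin m) : cartanD m i j = cartanD m j i := by
  unfold cartanD
  grind

theorem cartanD_nonneg_of_ne {m : ℕ} {i j : Fin m} (hij : i ≠ j) : 0 ≤ cartanD m i j := by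
  unfold cartanD
  rw [if_neg hij]
  split_ifs <;> norm_num

theorem bilinD_symm (m : ℕ) (x y : Fin m → ℚ) : bilinD m x y = bilinD m y x := by
  unfold bilinD
  rw [Finset.sum_comm]
  refine Finset.sum_congr rfl fun a _ => Finset.sum_congr rfl fun b _ => ?_
  rw [cartanD_symm m b a]
  ring

theorem bilinD_eD (m : ℕ) (x : Fin m → ℚ) (k : Fin m) :
    bilinD m x (eD m k) = ∑ a, x a * cartanD m a k := by
  simp [bilinD, eD]

theorem IsDualD.bilinD_eq {m : ℕ} {v : Fin m → ℚ} {i : Fin m} (hv : IsDualD m v i)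
    (y : Fin m → ℚ) : bilinD m v y = y i := by
  have h : bilinD m v y = ∑ k, bilinD m v (eD m k) * y k := by
    simp_rw [bilinD_eD, Finset.sum_mul]
    exact Finset.sum_comm
  rw [h, Finset.sum_congr rfl fun k _ => by rw [hv k]]
  simp

theorem neg_two_mul_le_bilinD_eD {m : ℕ} {x : Fin m → ℚ} (hx : ∀ k, 0 ≤ x k) (j : Fin m) :
    -2 * x j ≤ bilinD m x (eD m j) := by
  rw [bilinD_eD, ← Finset.add_sum_erase _ _ (Finset.mem_univ j)]
  have hdiag : x j * cartanD m j j = -2 * x j := by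
    simp [cartanD, mul_comm]
  have hoff : 0 ≤ ∑ a ∈ Finset.univ.erase j, x a * cartanD m a j :=
    Finset.sum_nonneg fun a ha =>
      mul_nonneg (hx a) (cartanD_nonneg_of_ne (Finset.ne_of_mem_erase ha))
  linarith

/-- Part (2) of the key lattice lemma, type `D`: if `e_i^∨ − e_j^∨` is a nonnegative
integral linear combination of `e_1,…,e_m`, then `⟨e_i^∨,e_i^∨⟩ > ⟨e_j^∨,e_j^∨⟩`
or `i = j`. -/
theorem dual_diff_nonneg_D (m : ℕ) (hm : 4 ≤ m) (i j : Fin m) (v w : Fin m → ℚ)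
    (hv : IsDualD m v i) (hw : IsDualD m w j)
    (h : ∃ c : Fin m → ℕ, v - w = ∑ k, (c k : ℚ) • eD m k) :
    bilinD m v v > bilinD m w w ∨ i = j := by
  by_cases hij : i = j
  · exact Or.inr hij
  left
  obtain ⟨c, hc⟩ := h
  have hd : ∀ k, (v - w) k = c k := fun k => by
    rw [hc]
    simp [Finset.sum_apply, eD]
  have hnonneg : ∀ k, 0 ≤ (v - w) k := fun k => by
    rw [hd]
    positivity
  have hpair : bilinD m (v - w) (eD m j) = -1 := by
    have hvj := hv j
    have hwj := hw j
    rw [if_neg (Ne.symm hij)] at hvj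
    rw [if_pos rfl] at hwj
    rw [bilinD_eD] at hvj hwj ⊢
    simp only [Pi.sub_apply, sub_mul, Finset.sum_sub_distrib]
    linarith
  have hle := neg_two_mul_le_bilinD_eD hnonneg j
  have hi := hnonneg i
  have hsymm := bilinD_symm m v w
  rw [hv.bilinD_eq, hw.bilinD_eq] at hsymm
  rw [hv.bilinD_eq, hw.bilinD_eq]
  simp only [Pi.sub_apply] at hle hi
  linarith
end

section
/- (Part (2) of the key lattice lemma, type E.) For each n ∈ {6,7,8} and all indices 1 ≤ i, j ≤ n, if e_i^∨ − e_j^∨ is a linear combination of e_1,…,e_n with nonnegative integer coefficients, then either ⟨e_i^∨, e_i^∨⟩ > ⟨e_j^∨, e_j^∨⟩ or i = j. -/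
open Finset

/-- Negated Cartan matrix of the root lattice of type `E_n` for `n ∈ {6,7,8}`
(indices `0,…,n-1` correspond to `e_1,…,e_n`; the Dynkin diagram is the chain
`e_2—e_3—⋯—e_n` with `e_1` attached to `e_4`). -/
def cartanE (n : ℕ) (i j : Fin n) : ℚ :=
  if i = j then -2
  else if ((i : ℕ) = 0 ∧ (j : ℕ) = 3) ∨ ((i : ℕ) = 3 ∧ (j : ℕ) = 0) then 1
  else if (((i : ℕ) + 1 = (j : ℕ) ∨ (j : ℕ) + 1 = (i : ℕ)) ∧ 1 ≤ (i : ℕ) ∧ 1 ≤ (j : ℕ))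
    then 1 else 0

/-- The symmetric bilinear form of the negative-definite root lattice of type `E_n`. -/
def bilinE (n : ℕ) (x y : Fin n → ℚ) : ℚ :=
  ∑ i, ∑ j, x i * cartanE n i j * y j

/-- The standard basis vector `e_j`. -/
def eE (n : ℕ) (j : Fin n) : Fin n → ℚ := fun k => if k = j then 1 else 0

/-- `v` is the dual basis vector `e_i^∨`, i.e. `⟨v, e_k⟩ = δ_{ik}` for all `k`. -/
def IsDualE (n : ℕ) (v : Fin n → ℚ) (i : Fin n) : Prop :=
  ∀ k : Fin n, bilinE n v (eE n k) = if k = i then 1 else 0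

theorem cartanE_comm (n : ℕ) (i j : Fin n) : cartanE n i j = cartanE n j i := by
  unfold cartanE
  congr 1
  · exact propext eq_comm
  · congr 1
    · exact propext (by tauto)
    · congr 1
      exact propext (by tauto)

theorem bilinE_comm (n : ℕ) (x y : Fin n → ℚ) : bilinE n x y = bilinE n y x := by
  unfold bilinE
  rw [Finset.sum_comm]
  refine Finset.sum_congr rfl fun i _ => Finset.sum_congr rfl fun j _ => ?_
  rw [cartanE_comm n j i]
  ring

theorem bilinE_sub_left (n : ℕ) (x y z : Fin n → ℚ) :
    bilinE n (x - y) z = bilinE n x z - bilinE n y z := by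
  simp only [bilinE, Pi.sub_apply, sub_mul, Finset.sum_sub_distrib]

theorem bilinE_sub_right (n : ℕ) (x y z : Fin n → ℚ) :
    bilinE n x (y - z) = bilinE n x y - bilinE n x z := by
  simp only [bilinE, Pi.sub_apply, mul_sub, Finset.sum_sub_distrib]

theorem bilinE_eE (n : ℕ) (x : Fin n → ℚ) (k : Fin n) :
    bilinE n x (eE n k) = ∑ i, x i * cartanE n i k := by
  simp [bilinE, eE]

theorem bilinE_eq_sum (n : ℕ) (x y : Fin n → ℚ) :
    bilinE n x y = ∑ k, y k * bilinE n x (eE n k) := by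
  simp only [bilinE_eE, Finset.mul_sum]
  unfold bilinE
  rw [Finset.sum_comm]
  exact Finset.sum_congr rfl fun k _ => Finset.sum_congr rfl fun i _ => mul_comm _ _

theorem IsDualE.bilinE_eq {n : ℕ} {v : Fin n → ℚ} {i : Fin n} (hv : IsDualE n v i)
    (y : Fin n → ℚ) : bilinE n v y = y i := by
  rw [bilinE_eq_sum]
  simp [hv _]

theorem IsDualE.index_unique {n : ℕ} {v : Fin n → ℚ} {i j : Fin n} (hi : IsDualE n v i)
    (hj : IsDualE n v j) : i = j := by
  by_contra hij
  have h := (hi i).symm.trans (hj i)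
  simp [hij] at h

theorem bilinE_six_self (x : Fin 6 → ℚ) :
    bilinE 6 x x = -(2 * (x 0 - x 3 / 2) ^ 2 + 2 * (x 1 - x 2 / 2) ^ 2
      + 3 / 2 * (x 2 - 2 / 3 * x 3) ^ 2 + 2 * (x 5 - x 4 / 2) ^ 2
      + 3 / 2 * (x 4 - 2 / 3 * x 3) ^ 2 + 1 / 6 * x 3 ^ 2) := by
  simp [bilinE, cartanE, Fin.sum_univ_six]
  ring

theorem bilinE_seven_self (x : Fin 7 → ℚ) :
    bilinE 7 x x = -(2 * (x 0 - x 3 / 2) ^ 2 + 2 * (x 1 - x 2 / 2) ^ 2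
      + 3 / 2 * (x 2 - 2 / 3 * x 3) ^ 2 + 2 * (x 6 - x 5 / 2) ^ 2
      + 3 / 2 * (x 5 - 2 / 3 * x 4) ^ 2 + 4 / 3 * (x 4 - 3 / 4 * x 3) ^ 2
      + 1 / 12 * x 3 ^ 2) := by
  simp [bilinE, cartanE, Fin.sum_univ_seven]
  ring

theorem bilinE_eight_self (x : Fin 8 → ℚ) :
    bilinE 8 x x = -(2 * (x 0 - x 3 / 2) ^ 2 + 2 * (x 1 - x 2 / 2) ^ 2
      + 3 / 2 * (x 2 - 2 / 3 * x 3) ^ 2 + 2 * (x 7 - x 6 / 2) ^ 2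
      + 3 / 2 * (x 6 - 2 / 3 * x 5) ^ 2 + 4 / 3 * (x 5 - 3 / 4 * x 4) ^ 2
      + 5 / 4 * (x 4 - 4 / 5 * x 3) ^ 2 + 1 / 30 * x 3 ^ 2) := by
  simp [bilinE, cartanE, Fin.sum_univ_eight]
  ring

theorem eq_zero_of_bilinE_self_eq_zero (n : ℕ) (hn : n = 6 ∨ n = 7 ∨ n = 8) (x : Fin n → ℚ)
    (hx : bilinE n x x = 0) : x = 0 := by
  rcases hn with rfl | rfl | rfl
  · rw [bilinE_six_self, neg_eq_zero] at hx
    simp (discharger := positivity) only [add_eq_zero_iff_of_nonneg, mul_eq_zero,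
      pow_eq_zero_iff two_ne_zero] at hx
    norm_num at hx
    obtain ⟨⟨⟨⟨⟨h0, h1⟩, h2⟩, h3⟩, h4⟩, h5⟩ := hx
    funext k
    fin_cases k <;> simp <;> linarith
  · rw [bilinE_seven_self, neg_eq_zero] at hx
    simp (discharger := positivity) only [add_eq_zero_iff_of_nonneg, mul_eq_zero,
      pow_eq_zero_iff two_ne_zero] at hx
    norm_num at hx
    obtain ⟨⟨⟨⟨⟨⟨h0, h1⟩, h2⟩, h3⟩, h4⟩, h5⟩, h6⟩ := hx
    funext k
    fin_cases k <;> simp <;> linarith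
  · rw [bilinE_eight_self, neg_eq_zero] at hx
    simp (discharger := positivity) only [add_eq_zero_iff_of_nonneg, mul_eq_zero,
      pow_eq_zero_iff two_ne_zero] at hx
    norm_num at hx
    obtain ⟨⟨⟨⟨⟨⟨⟨h0, h1⟩, h2⟩, h3⟩, h4⟩, h5⟩, h6⟩, h7⟩ := hx
    funext k
    fin_cases k <;> simp <;> linarith

/-- Part (2) of the key lattice lemma, type `E`: for each `n ∈ {6,7,8}`, if
`e_i^∨ − e_j^∨` is a nonnegative integral linear combination of `e_1,…,e_n`,
then `⟨e_i^∨,e_i^∨⟩ > ⟨e_j^∨,e_j^∨⟩` or `i = j`. -/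
theorem dual_diff_nonneg_E (n : ℕ) (hn : n = 6 ∨ n = 7 ∨ n = 8) (i j : Fin n)
    (v w : Fin n → ℚ) (hv : IsDualE n v i) (hw : IsDualE n w j)
    (h : ∃ c : Fin n → ℕ, v - w = ∑ k, (c k : ℚ) • eE n k) :
    bilinE n v v > bilinE n w w ∨ i = j := by
  obtain ⟨c, hc⟩ := h
  have hcoord : ∀ k, (v - w) k = c k := fun k => by
    rw [hc]
    simp [eE, Finset.sum_apply]
  have hvc : bilinE n v v - bilinE n v w = c i := by
    rw [← bilinE_sub_right, hv.bilinE_eq, hcoord]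
  have hwc : bilinE n v w - bilinE n w w = c j := by
    rw [bilinE_comm n v w, ← bilinE_sub_right, hw.bilinE_eq, hcoord]
  have hi : (0 : ℚ) ≤ c i := Nat.cast_nonneg _
  have hj : (0 : ℚ) ≤ c j := Nat.cast_nonneg _
  refine or_iff_not_imp_left.mpr fun hle => ?_
  have hself : bilinE n (v - w) (v - w) = 0 := by
    rw [bilinE_sub_left, bilinE_sub_right, bilinE_sub_right, bilinE_comm n w v]
    linarith
  have hvw : v = w := sub_eq_zero.mp (eq_zero_of_bilinE_self_eq_zero n hn _ hself)
  exact hv.index_unique (hvw ▸ hw)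
end
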